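/- arXiv:1804.02513 — 5 statements merged into one kernel-verified Lean document; each statement's English description precedes it below -/
import Mathlib

section
/- Let G be a finite simple graph and k ≥ 1 a natural number. If every nonempty induced subgraph of G contains a vertex whose degree within that induced subgraph is at most k (i.e., G is k-degenerate), then the edge set of G can be partitioned into at most k forests, i.e., there is a function assigning to each edge of G one of k labels such that for each label the spanning subgraph consisting of the edges with that label is acyclic. In particular, the arboricity of G is at most its degeneracy. -/
theorem arboricity_aux {V : Type*} [Fintype V] [DecidableEq V]
    (G : SimpleGraph V) [DecidableRel G.Adj] (k : ℕ) (hk : 1 ≤ k)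
    (hdeg : ∀ s : Finset V, s.Nonempty →
      ∃ v ∈ s, (s.filter (fun u => G.Adj v u)).card ≤ k) (n : ℕ) :
    ∀ s : Finset V, s.card = n → ∃ f : Sym2 V → Fin k, ∀ c : Fin k,
      (SimpleGraph.fromEdgeSet
        {e : Sym2 V | e ∈ G.edgeSet ∧ (∀ x ∈ e, x ∈ s) ∧ f e = c}).IsAcyclic := by
  classical
  induction n with
  | zero =>
    intro s hs
    rw [Finset.card_eq_zero] at hs
    subst hs
    refine ⟨fun _ => ⟨0, hk⟩, fun c => ?_⟩
    refine SimpleGraph.IsAcyclic.anti (G' := ⊥) ?_ SimpleGraph.isAcyclic_bot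
    intro a b hab
    rw [SimpleGraph.fromEdgeSet_adj] at hab
    have := hab.1.2.1 a (by simp)
    simp at this
  | succ n ih =>
    intro s hs
    obtain ⟨v, hv, hcard⟩ := hdeg s (Finset.card_pos.mp (by omega))
    obtain ⟨f, hf⟩ := ih (s.erase v) (by rw [Finset.card_erase_of_mem hv]; omega)
    obtain ⟨e⟩ : Nonempty ((s.filter (fun u => G.Adj v u)) ↪ Fin k) :=
      Function.Embedding.nonempty_of_card_le (by rw [Fintype.card_coe, Fintype.card_fin]; exact hcard)
    let g : V → Fin k := fun w =>
      if h : w ∈ s.filter (fun u => G.Adj v u) then e ⟨w, h⟩ else ⟨0, hk⟩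
    have hg : ∀ a b, a ∈ s → b ∈ s → G.Adj v a → G.Adj v b → g a = g b → a = b := by
      intro a b ha hb hva hvb hab
      simp only [g] at hab
      rw [dif_pos (by simp [ha, hva]), dif_pos (by simp [hb, hvb])] at hab
      simpa using e.injective hab
    let f' : Sym2 V → Fin k := fun x => if h : v ∈ x then g (Sym2.Mem.other h) else f x
    have hf'v : ∀ w, f' s(v, w) = g w := by
      intro w
      have h : v ∈ s(v, w) := by simp
      simp only [f']
      rw [dif_pos h]
      congr 1
      exact Sym2.congr_right.mp (Sym2.other_spec h)
    have hf'n : ∀ a b, a ≠ v → b ≠ v → f' s(a, b) = f s(a, b) := by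
      intro a b ha hb
      simp only [f']
      rw [dif_neg]
      simp [ha.symm, hb.symm]
    refine ⟨f', fun c => ?_⟩
    set H := SimpleGraph.fromEdgeSet
        {e : Sym2 V | e ∈ G.edgeSet ∧ (∀ x ∈ e, x ∈ s.erase v) ∧ f e = c} with hH
    have hiso : ∀ w, ¬ H.Adj v w := by
      intro w h
      rw [hH, SimpleGraph.fromEdgeSet_adj] at h
      have := h.1.2.1 v (by simp)
      simp at this
    -- a single vertex to which `v` may be joined in colour `c`
    have key : ∀ w, w ≠ v → (∀ u, u ∈ s → G.Adj v u → g u = c → u = w) →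
        (SimpleGraph.fromEdgeSet
          {e : Sym2 V | e ∈ G.edgeSet ∧ (∀ x ∈ e, x ∈ s) ∧ f' e = c}).IsAcyclic := by
      intro w hwv huniq
      have hnr : ¬ H.Reachable v w := by
        rintro ⟨p⟩
        cases p with
        | nil => exact hwv rfl
        | cons h _ => exact hiso _ h
      refine SimpleGraph.IsAcyclic.anti ?_
        (SimpleGraph.IsAcyclic.sup_edge_of_not_reachable hnr (hf c))
      intro a b hab
      rw [SimpleGraph.fromEdgeSet_adj] at hab
      obtain ⟨⟨hG, hs', hc⟩, hne⟩ := hab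
      have ha : a ∈ s := hs' a (by simp)
      have hb : b ∈ s := hs' b (by simp)
      rw [SimpleGraph.mem_edgeSet] at hG
      rw [SimpleGraph.sup_adj, SimpleGraph.edge_adj]
      by_cases hav : a = v
      · subst hav
        rw [hf'v] at hc
        exact Or.inr ⟨Or.inl ⟨rfl, huniq b hb hG hc⟩, hne⟩
      by_cases hbv : b = v
      · subst hbv
        rw [Sym2.eq_swap, hf'v] at hc
        exact Or.inr ⟨Or.inr ⟨huniq a ha hG.symm hc, rfl⟩, hne⟩
      left
      rw [hf'n a b hav hbv] at hc
      rw [hH, SimpleGraph.fromEdgeSet_adj]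
      refine ⟨⟨hG, ?_, hc⟩, hne⟩
      intro x hx
      rcases Sym2.mem_iff.mp hx with rfl | rfl
      · simp [hav, ha]
      · simp [hbv, hb]
    by_cases hex : ∃ w ∈ s, G.Adj v w ∧ g w = c
    · obtain ⟨w, hw, hvw, hgw⟩ := hex
      exact key w hvw.ne' fun u hu hvu hgu => hg u w hu hw hvu hvw (hgu.trans hgw.symm)
    · by_cases hV : ∃ w, w ≠ v
      · obtain ⟨w, hw⟩ := hV
        exact key w hw fun u hu hvu hgu => (hex ⟨u, hu, hvu, hgu⟩).elim
      · push Not at hV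
        have : Subsingleton V := ⟨fun a b => (hV a).trans (hV b).symm⟩
        exact SimpleGraph.IsAcyclic.of_subsingleton

/-- If a finite simple graph `G` is `k`-degenerate (every nonempty induced subgraph has a
vertex of degree at most `k` inside it), with `k ≥ 1`, then the edges of `G` can be labelled
with `k` labels so that each label class forms a forest (acyclic spanning subgraph).
In particular the arboricity of `G` is at most its degeneracy. -/
theorem arboricity_le_degeneracy {V : Type*} [Fintype V] [DecidableEq V]
    (G : SimpleGraph V) [DecidableRel G.Adj] (k : ℕ) (hk : 1 ≤ k)
    (hdeg : ∀ s : Finset V, s.Nonempty →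
      ∃ v ∈ s, (s.filter (fun u => G.Adj v u)).card ≤ k) :
    ∃ f : G.edgeSet → Fin k, ∀ c : Fin k,
      (SimpleGraph.fromEdgeSet {e : Sym2 V | ∃ h : e ∈ G.edgeSet, f ⟨e, h⟩ = c}).IsAcyclic := by
  obtain ⟨f, hf⟩ := arboricity_aux G k hk hdeg _ Finset.univ rfl
  refine ⟨fun e => f e.1, fun c => (hf c).anti ?_⟩
  apply SimpleGraph.fromEdgeSet_mono
  rintro e ⟨h, hc⟩
  exact ⟨h, fun x _ => Finset.mem_univ x, hc⟩
end

section
/- Let β > 2 be a real number and let n, m be natural numbers with 1 ≤ m ≤ n−1. Define w_i = (n/(n−i))^{1/(β−1)} for 1 ≤ i ≤ n−1. Then ∑_{i=m}^{n−1} w_i ≤ ((β−1)/(β−2)) · n · w_m^{2−β}. -/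
lemma weight_aux (s N : ℝ) (hs : 0 < s) (hs1 : s ≤ 1) (hN : 0 < N) (K : ℕ) :
    ∑ k ∈ Finset.range K, (N / ((k : ℝ) + 1)) ^ (1 - s) ≤ 1 / s * N * ((K : ℝ) / N) ^ s := by
  induction K with
  | zero => simp [Real.zero_rpow hs.ne']
  | succ K ih =>
    rw [Finset.sum_range_succ]
    have hK : (0 : ℝ) < (K : ℝ) + 1 := by positivity
    obtain ⟨x, hx⟩ : ∃ x, x = ((K : ℝ) + 1) / N := ⟨_, rfl⟩
    have hx0 : 0 < x := by rw [hx]; positivity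
    have h1 : (N / ((K : ℝ) + 1)) ^ (1 - s) = x ^ s / x := by
      have : N / ((K : ℝ) + 1) = x⁻¹ := by rw [hx, inv_div]
      rw [this, Real.inv_rpow hx0.le, ← Real.rpow_neg hx0.le, neg_sub, Real.rpow_sub hx0,
        Real.rpow_one]
    have hle : 1 / ((K : ℝ) + 1) ≤ 1 := by
      rw [div_le_one hK]; have : (0 : ℝ) ≤ K := by positivity
      linarith
    have h2 : ((K : ℝ) / N) ^ s = x ^ s * (1 + -(1 / ((K : ℝ) + 1))) ^ s := by
      rw [← Real.mul_rpow hx0.le (by linarith)]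
      congr 1
      rw [hx]; field_simp; ring
    have h3 : (1 + -(1 / ((K : ℝ) + 1))) ^ s ≤ 1 + s * -(1 / ((K : ℝ) + 1)) :=
      rpow_one_add_le_one_add_mul_self (by linarith) hs.le hs1
    have hpos : 0 < x ^ s := Real.rpow_pos_of_pos hx0 s
    have h4 := mul_le_mul_of_nonneg_left h3 (show 0 ≤ 1 / s * N * x ^ s by positivity)
    have h5 : 1 / s * N * x ^ s * (1 + s * -(1 / ((K : ℝ) + 1)))
        = 1 / s * N * x ^ s - x ^ s / x := by
      have : N = ((K : ℝ) + 1) / x := by rw [hx]; field_simp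
      rw [this]; field_simp; ring
    rw [h1]
    rw [h2] at ih
    push_cast
    rw [← hx]
    nlinarith

/-- For `β > 2`, `1 ≤ m ≤ n−1`, and weights `w_i = (n/(n−i))^(1/(β−1))`,
`∑_{i=m}^{n−1} w_i ≤ ((β−1)/(β−2)) · n · w_m^(2−β)`. -/
theorem weight_sum_upper (β : ℝ) (hβ : 2 < β) (n m : ℕ) (hm : 1 ≤ m) (hmn : m ≤ n - 1) :
    ∑ i ∈ Finset.Icc m (n - 1), ((n : ℝ) / ((n : ℝ) - (i : ℝ))) ^ ((1 : ℝ) / (β - 1))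
      ≤ ((β - 1) / (β - 2)) * n *
        (((n : ℝ) / ((n : ℝ) - (m : ℝ))) ^ ((1 : ℝ) / (β - 1))) ^ ((2 : ℝ) - β) := by
  have hb1 : 0 < β - 1 := by linarith
  have hb2 : 0 < β - 2 := by linarith
  have hn : 0 < n := by omega
  have hN : (0 : ℝ) < n := by exact_mod_cast hn
  have hmn' : m < n := by omega
  have hd : (0 : ℝ) < (n : ℝ) - m := sub_pos.2 (by exact_mod_cast hmn')
  have key := weight_aux ((β - 2) / (β - 1)) n (by positivity)
    (by rw [div_le_one hb1]; linarith) hN (n - m)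
  have e1 : 1 - (β - 2) / (β - 1) = 1 / (β - 1) := by field_simp; ring
  rw [e1, Nat.cast_sub hmn'.le, one_div_div] at key
  have e2 : (((n : ℝ) / ((n : ℝ) - (m : ℝ))) ^ ((1 : ℝ) / (β - 1))) ^ ((2 : ℝ) - β)
      = (((n : ℝ) - m) / n) ^ ((β - 2) / (β - 1)) := by
    rw [← Real.rpow_mul (by positivity), ← inv_div, Real.inv_rpow (by positivity),
      ← Real.rpow_neg (by positivity)]
    congr 1
    field_simp; ring
  rw [e2]
  refine le_trans (le_of_eq ?_) key
  refine Finset.sum_nbij' (fun i => n - 1 - i) (fun i => n - 1 - i) ?_ ?_ ?_ ?_ ?_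
  · intro i hi; simp at hi ⊢; omega
  · intro i hi; simp at hi ⊢; omega
  · intro i hi; simp at hi ⊢; omega
  · intro i hi; simp at hi ⊢; omega
  · intro i hi
    simp only [Finset.mem_Icc] at hi
    have : ((n - 1 - i : ℕ) : ℝ) + 1 = n - i := by
      rw [eq_sub_iff_add_eq]
      exact_mod_cast (by omega : n - 1 - i + 1 + i = n)
    rw [this]
end

section
/- Let β > 2 be a real number and let n, m be natural numbers with 1 ≤ m ≤ n−1. Define w_i = (n/(n−i))^{1/(β−1)} for 1 ≤ i ≤ n−1. Then ∑_{i=m}^{n−1} w_i ≥ n · w_m^{2−β}. -/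
/-- For `β > 2`, `1 ≤ m ≤ n−1`, and weights `w_i = (n/(n−i))^(1/(β−1))`,
`∑_{i=m}^{n−1} w_i ≥ n · w_m^(2−β)`. -/
theorem weight_sum_lower (β : ℝ) (hβ : 2 < β) (n m : ℕ) (hm : 1 ≤ m) (hmn : m ≤ n - 1) :
    (n : ℝ) * (((n : ℝ) / ((n : ℝ) - (m : ℝ))) ^ ((1 : ℝ) / (β - 1))) ^ ((2 : ℝ) - β)
      ≤ ∑ i ∈ Finset.Icc m (n - 1), ((n : ℝ) / ((n : ℝ) - (i : ℝ))) ^ ((1 : ℝ) / (β - 1)) := by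
  have hlt : m < n := by omega
  have hnm : (0 : ℝ) < (n : ℝ) - m := sub_pos.mpr (by exact_mod_cast hlt)
  have hn : (0 : ℝ) < n := by exact_mod_cast (by omega : 0 < n)
  have hb : β - 1 ≠ 0 := by linarith
  have hx : (0 : ℝ) < (n : ℝ) / ((n : ℝ) - m) := div_pos hn hnm
  have key : (n : ℝ) * (((n : ℝ) / ((n : ℝ) - (m : ℝ))) ^ ((1 : ℝ) / (β - 1))) ^ ((2 : ℝ) - β)
      = ((n : ℝ) - m) * ((n : ℝ) / ((n : ℝ) - (m : ℝ))) ^ ((1 : ℝ) / (β - 1)) := by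
    have he : (1 : ℝ) / (β - 1) * (2 - β) = 1 / (β - 1) - 1 := by
      field_simp
      ring
    rw [← Real.rpow_mul hx.le, he, Real.rpow_sub_one hx.ne']
    field_simp
  rw [key]
  have hcard : (((Finset.Icc m (n - 1)).card : ℕ) : ℝ) = (n : ℝ) - m := by
    rw [Nat.card_Icc, show n - 1 + 1 - m = n - m by omega, Nat.cast_sub hlt.le]
  rw [← hcard, ← nsmul_eq_mul]
  apply Finset.card_nsmul_le_sum
  intro i hi
  rw [Finset.mem_Icc] at hi
  have hin : (0 : ℝ) < (n : ℝ) - i := sub_pos.mpr (by exact_mod_cast (by omega : i < n))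
  have hmi : (m : ℝ) ≤ i := by exact_mod_cast hi.1
  rw [hcard]
  apply Real.rpow_le_rpow hx.le
  · exact div_le_div_of_nonneg_left hn.le hin (by linarith)
  · exact div_nonneg zero_le_one (by linarith)
end

section
/- Let β ≥ 3 be a real number and let n, m be natural numbers with 1 ≤ m ≤ n−1. Define w_i = (n/(n−i))^{1/(β−1)} for 1 ≤ i ≤ n−1. Then (w_m/n) · ∑_{i=m}^{n−1} w_i ≤ (β−1)/(β−2). -/
theorem aux_sum (a : ℝ) (ha : 0 < a) (ha1 : a < 1) (k : ℕ) :
    (1 - a) * ∑ j ∈ Finset.range k, ((j : ℝ) + 1) ^ (-a) ≤ (k : ℝ) ^ (1 - a) := by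
  induction k with
  | zero => simp [Real.zero_rpow (by linarith : (1 - a) ≠ 0)]
  | succ k ih =>
    rw [Finset.sum_range_succ, mul_add]
    have hk : (0 : ℝ) < (k : ℝ) + 1 := by positivity
    have hs : (-1 : ℝ) ≤ -(1 / ((k : ℝ) + 1)) := by
      rw [neg_le_neg_iff, div_le_one hk]
      linarith [(Nat.cast_nonneg k : (0 : ℝ) ≤ k)]
    have hb := rpow_one_add_le_one_add_mul_self hs (p := 1 - a) (by linarith) (by linarith)
    have h1 : 1 + -(1 / ((k : ℝ) + 1)) = (k : ℝ) / (k + 1) := by field_simp; ring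
    rw [h1, Real.div_rpow (by positivity) hk.le, div_le_iff₀ (by positivity)] at hb
    have h2 : ((k : ℝ) + 1) ^ (-a) = ((k : ℝ) + 1) ^ (1 - a) / (k + 1) := by
      rw [← Real.rpow_sub_one hk.ne']
      congr 1
      ring
    rw [h2]
    push_cast
    have h3 : (1 + (1 - a) * -(1 / ((k : ℝ) + 1))) * ((k : ℝ) + 1) ^ (1 - a)
        = ((k : ℝ) + 1) ^ (1 - a) - (1 - a) * (((k : ℝ) + 1) ^ (1 - a) / (k + 1)) := by ring
    rw [h3] at hb
    linarith

/-- For `β ≥ 3`, `1 ≤ m ≤ n−1`, and weights `w_i = (n/(n−i))^(1/(β−1))`,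
`(w_m/n) · ∑_{i=m}^{n−1} w_i ≤ (β−1)/(β−2)`. -/
theorem weight_sum_normalized_le (β : ℝ) (hβ : 3 ≤ β) (n m : ℕ) (hm : 1 ≤ m) (hmn : m ≤ n - 1) :
    (((n : ℝ) / ((n : ℝ) - (m : ℝ))) ^ ((1 : ℝ) / (β - 1)) / n) *
        ∑ i ∈ Finset.Icc m (n - 1), ((n : ℝ) / ((n : ℝ) - (i : ℝ))) ^ ((1 : ℝ) / (β - 1))
      ≤ (β - 1) / (β - 2) := by
  have hb1 : (0 : ℝ) < β - 1 := by linarith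
  have hb2 : (0 : ℝ) < β - 2 := by linarith
  have hfin : (β - 1) / (β - 2) = 1 / (1 - 1 / (β - 1)) := by
    have : 1 - 1 / (β - 1) = (β - 2) / (β - 1) := by field_simp; ring
    rw [this, one_div_div]
  rw [hfin]
  have ha : 0 < 1 / (β - 1) := by positivity
  have ha2 : 1 / (β - 1) ≤ 1 / 2 := one_div_le_one_div_of_le (by norm_num) (by linarith)
  generalize 1 / (β - 1) = a at *
  obtain ⟨k, rfl⟩ : ∃ k, n = m + k := ⟨n - m, by omega⟩
  have hk1 : 1 ≤ k := by omega
  have hk : (0 : ℝ) < k := by exact_mod_cast hk1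
  have hn : (0 : ℝ) < ((m + k : ℕ) : ℝ) := by exact_mod_cast (by omega : 0 < m + k)
  have hkn : (k : ℝ) ≤ ((m + k : ℕ) : ℝ) := by exact_mod_cast (by omega : k ≤ m + k)
  have hsub : ((m + k : ℕ) : ℝ) - m = k := by push_cast; ring
  have hsum : ∑ i ∈ Finset.Icc m (m + k - 1), (((m + k : ℕ) : ℝ) / (((m + k : ℕ) : ℝ) - (i : ℝ))) ^ a
      = ((m + k : ℕ) : ℝ) ^ a * ∑ j ∈ Finset.range k, ((j : ℝ) + 1) ^ (-a) := by
    have : Finset.Icc m (m + k - 1) = Finset.Ico m (m + k) := by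
      ext i; simp only [Finset.mem_Icc, Finset.mem_Ico]; omega
    rw [this, Finset.sum_Ico_eq_sum_range, Nat.add_sub_cancel_left, Finset.mul_sum,
      ← Finset.sum_range_reflect]
    refine Finset.sum_congr rfl fun j hj => ?_
    have hj := Finset.mem_range.1 hj
    have h : ((m + k : ℕ) : ℝ) - ((m + (k - 1 - j) : ℕ) : ℝ) = (j : ℝ) + 1 := by
      rw [sub_eq_iff_eq_add]
      exact_mod_cast (by omega : m + k = j + 1 + (m + (k - 1 - j)))
    rw [h, Real.div_rpow hn.le (by positivity), Real.rpow_neg (by positivity), div_eq_mul_inv]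
  rw [hsub, hsum]
  have hS := aux_sum a ha (by linarith) k
  generalize ∑ j ∈ Finset.range k, ((j : ℝ) + 1) ^ (-a) = S at *
  generalize ((m + k : ℕ) : ℝ) = N at *
  rw [le_div_iff₀ (by linarith)]
  have e : ((N / k) ^ a / N * N ^ a) * (k : ℝ) ^ (1 - a) = ((k : ℝ) / N) ^ (1 - 2 * a) := by
    rw [Real.div_rpow hn.le hk.le, Real.div_rpow hk.le hn.le,
      show 1 - 2 * a = 1 - a - a by ring, Real.rpow_sub hk (1 - a) a, Real.rpow_sub hn (1 - a) a,
      Real.rpow_sub hn 1 a, Real.rpow_one]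
    field_simp
  calc _ = ((N / k) ^ a / N * N ^ a) * ((1 - a) * S) := by ring
    _ ≤ ((N / k) ^ a / N * N ^ a) * (k : ℝ) ^ (1 - a) := by gcongr
    _ = _ := e
    _ ≤ 1 := Real.rpow_le_one (by positivity) ((div_le_one hn).2 hkn) (by linarith)
end

section
/- Let β ≥ 3 be a real number and n a natural number with log n ≥ 2 (log the natural logarithm). Let M = ⌊n/(log n)²⌋. Then (log n / n) · ∑_{i = n−M+1}^{n−1} (n/(n−i))^{1/(β−1)} ≤ 4. -/
theorem heavy_aux (e : ℝ) (he0 : 0 ≤ e) (he : e ≤ 1 / 2) (n : ℕ) (m : ℕ) (hm : m ≤ n) :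
    ∑ i ∈ Finset.Icc (n - m) (n - 1), ((n : ℝ) / ((n : ℝ) - (i : ℝ))) ^ e
      ≤ 2 * √(n : ℝ) * √(m : ℝ) + (if m = 0 ∧ n = 0 then 1 else 0) := by
  induction m with
  | zero =>
    rcases Nat.eq_zero_or_pos n with h | h
    · subst h
      simp only [Nat.sub_self, Nat.zero_sub, Finset.Icc_self, Finset.sum_singleton]
      simpa using Real.zero_rpow_le_one e
    · rw [Finset.Icc_eq_empty (by omega)]
      simp only [Finset.sum_empty]
      positivity
  | succ m ih =>
    have ih := ih (by omega)
    have hn : n ≠ 0 := by omega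
    simp only [hn, and_false, if_false, add_zero] at ih ⊢
    have hI : Finset.Icc (n - (m + 1)) (n - 1)
        = insert (n - (m + 1)) (Finset.Icc (n - m) (n - 1)) := by
      ext x
      simp only [Finset.mem_Icc, Finset.mem_insert]
      omega
    rw [hI, Finset.sum_insert (by simp only [Finset.mem_Icc]; omega)]
    have hc : (n : ℝ) - ((n - (m + 1) : ℕ) : ℝ) = (m : ℝ) + 1 := by
      rw [Nat.cast_sub hm]; push_cast; ring
    rw [hc]
    have hmn : (m : ℝ) + 1 ≤ n := by exact_mod_cast hm
    have hm0 : (0 : ℝ) ≤ m := Nat.cast_nonneg m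
    have h1 : ((n : ℝ) / ((m : ℝ) + 1)) ^ e ≤ √(n : ℝ) / √((m : ℝ) + 1) := by
      rw [← Real.sqrt_div (Nat.cast_nonneg n), Real.sqrt_eq_rpow]
      apply Real.rpow_le_rpow_of_exponent_le _ he
      rw [le_div_iff₀ (by positivity)]; linarith
    have h2 : 1 / √((m : ℝ) + 1) ≤ 2 * (√((m : ℝ) + 1) - √(m : ℝ)) := by
      rw [div_le_iff₀ (by positivity)]
      nlinarith [Real.sq_sqrt hm0, Real.sq_sqrt (show (0 : ℝ) ≤ m + 1 by positivity),
        sq_nonneg (√((m : ℝ) + 1) - √(m : ℝ))]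
    have h3 := mul_le_mul_of_nonneg_left h2 (Real.sqrt_nonneg (n : ℝ))
    rw [mul_one_div] at h3
    push_cast
    linarith

/-- For `β ≥ 3` and `n` with `log n ≥ 2`, setting `M = ⌊n/(log n)²⌋`,
`(log n / n) · ∑_{i=n−M+1}^{n−1} (n/(n−i))^(1/(β−1)) ≤ 4`. -/
theorem heavy_tail_sum_le (β : ℝ) (hβ : 3 ≤ β) (n : ℕ) (hn : 2 ≤ Real.log n) :
    (Real.log n / n) *
        ∑ i ∈ Finset.Icc (n - ⌊(n : ℝ) / (Real.log n) ^ 2⌋₊ + 1) (n - 1),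
          ((n : ℝ) / ((n : ℝ) - (i : ℝ))) ^ ((1 : ℝ) / (β - 1))
      ≤ 4 := by
  have hn0 : n ≠ 0 := by
    rintro rfl
    norm_num at hn
  have hnpos : (0 : ℝ) < n := by positivity
  set L := Real.log n with hL
  have hLpos : 0 < L := by linarith
  have hfl : (⌊(n : ℝ) / L ^ 2⌋₊ : ℝ) ≤ (n : ℝ) / L ^ 2 := Nat.floor_le (by positivity)
  set M := ⌊(n : ℝ) / L ^ 2⌋₊ with hM
  rcases Nat.eq_zero_or_pos M with h0 | h0
  · rw [Finset.Icc_eq_empty (by omega)]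
    simp
  have hle : (n : ℝ) / L ^ 2 ≤ n := div_le_self hnpos.le (by nlinarith)
  have hMn : M ≤ n := by exact_mod_cast hfl.trans hle
  have hidx : n - M + 1 = n - (M - 1) := by omega
  have he : (1 : ℝ) / (β - 1) ≤ 1 / 2 := one_div_le_one_div_of_le (by norm_num) (by linarith)
  have key := heavy_aux (1 / (β - 1)) (one_div_nonneg.mpr (by linarith)) he n (M - 1) (by omega)
  simp only [hn0, and_false, if_false, add_zero] at key
  rw [hidx]
  have hs : √((M - 1 : ℕ) : ℝ) ≤ √(n : ℝ) / L := by
    rw [← Real.sqrt_sq hLpos.le, ← Real.sqrt_div hnpos.le]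
    apply Real.sqrt_le_sqrt
    refine le_trans ?_ hfl
    exact_mod_cast Nat.sub_le M 1
  calc _ ≤ (L / n) * (2 * √(n : ℝ) * (√(n : ℝ) / L)) := by
        apply mul_le_mul_of_nonneg_left _ (by positivity)
        exact key.trans (mul_le_mul_of_nonneg_left hs (by positivity))
    _ = 2 * (√(n : ℝ) * √(n : ℝ)) / n := by field_simp
    _ = 2 := by rw [Real.mul_self_sqrt hnpos.le]; field_simp
    _ ≤ 4 := by norm_num
end
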